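/- For every parameter vector η ∈ ℝ^n with all components positive, every i = 1, …, n, and every h > 0, there holds the chain of inequalities 0 ≤ ∂_i⁺F(η + h e_i) ≤ ∂_i⁻F(η + h e_i) ≤ ∂_i⁺F(η) ≤ ∂_i⁻F(η). -/

import Mathlib

open Filter Set Topology

/-- The value function `F(η) = inf_{x ∈ Q} (φ(x) + Σ_i η_i ψ_i(x))` of
multi-parameter Tikhonov regularization. -/
noncomputable def valueFun {X : Type*} {n : ℕ} (Q : Set X) (φ : X → ℝ)
    (ψ : Fin n → X → ℝ) (η : Fin n → ℝ) : ℝ :=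
  sInf ((fun x => φ x + ∑ i, η i * ψ i x) '' Q)

/-- `HasDPlus F η i D` says that the right-sided partial derivative
`∂_i⁺F(η) = lim_{h→0⁺} (F(η + h eᵢ) - F(η))/h` exists and equals `D`. -/
def HasDPlus {n : ℕ} (F : (Fin n → ℝ) → ℝ) (η : Fin n → ℝ) (i : Fin n) (D : ℝ) : Prop :=
  Filter.Tendsto (fun h : ℝ => (F (η + h • (Pi.single i 1 : Fin n → ℝ)) - F η) / h)
    (nhdsWithin 0 (Set.Ioi 0)) (nhds D)

/-- `HasDMinus F η i D` says that the left-sided partial derivative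
`∂_i⁻F(η) = lim_{h→0⁺} (F(η) - F(η - h eᵢ))/h` exists and equals `D`. -/
def HasDMinus {n : ℕ} (F : (Fin n → ℝ) → ℝ) (η : Fin n → ℝ) (i : Fin n) (D : ℝ) : Prop :=
  Filter.Tendsto (fun h : ℝ => (F η - F (η - h • (Pi.single i 1 : Fin n → ℝ))) / h)
    (nhdsWithin 0 (Set.Ioi 0)) (nhds D)

theorem valueFun_le {X : Type*} {n : ℕ} {Q : Set X} {φ : X → ℝ} (hφ : ∀ x, 0 ≤ φ x)
    {ψ : Fin n → X → ℝ} (hψ : ∀ i x, 0 ≤ ψ i x) {η : Fin n → ℝ} (hη : 0 ≤ η)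
    {x : X} (hx : x ∈ Q) : valueFun Q φ ψ η ≤ φ x + ∑ i, η i * ψ i x := by
  refine csInf_le ⟨0, ?_⟩ (mem_image_of_mem _ hx)
  rintro _ ⟨y, -, rfl⟩
  exact add_nonneg (hφ y) (Finset.sum_nonneg fun i _ => mul_nonneg (hη i) (hψ i y))

theorem le_valueFun {X : Type*} {n : ℕ} {Q : Set X} (hQ : Q.Nonempty) {φ : X → ℝ}
    {ψ : Fin n → X → ℝ} {η : Fin n → ℝ} {c : ℝ}
    (hc : ∀ x ∈ Q, c ≤ φ x + ∑ i, η i * ψ i x) : c ≤ valueFun Q φ ψ η :=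
  le_csInf (hQ.image _) (forall_mem_image.2 hc)

theorem monotoneOn_valueFun {X : Type*} {n : ℕ} {Q : Set X} (hQ : Q.Nonempty)
    {φ : X → ℝ} (hφ : ∀ x, 0 ≤ φ x) {ψ : Fin n → X → ℝ} (hψ : ∀ i x, 0 ≤ ψ i x) :
    MonotoneOn (valueFun Q φ ψ) (Ici 0) := by
  intro η hη ξ _ hle
  refine le_valueFun hQ fun x hx => (valueFun_le hφ hψ hη hx).trans ?_
  gcongr with j
  · exact hψ j x
  · exact hle j

theorem concaveOn_valueFun {X : Type*} {n : ℕ} {Q : Set X} (hQ : Q.Nonempty)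
    {φ : X → ℝ} (hφ : ∀ x, 0 ≤ φ x) {ψ : Fin n → X → ℝ} (hψ : ∀ i x, 0 ≤ ψ i x) :
    ConcaveOn ℝ (Ici 0) (valueFun Q φ ψ) := by
  refine ⟨convex_Ici 0, fun η hη ξ hξ a b ha hb hab => le_valueFun hQ fun x hx => ?_⟩
  calc a • valueFun Q φ ψ η + b • valueFun Q φ ψ ξ
      ≤ a * (φ x + ∑ i, η i * ψ i x) + b * (φ x + ∑ i, ξ i * ψ i x) :=
        add_le_add (mul_le_mul_of_nonneg_left (valueFun_le hφ hψ hη hx) ha)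
          (mul_le_mul_of_nonneg_left (valueFun_le hφ hψ hξ hx) hb)
    _ = (a + b) * φ x + ∑ i, (a • η + b • ξ) i * ψ i x := by
        simp only [Pi.add_apply, Pi.smul_apply, smul_eq_mul, add_mul, Finset.sum_add_distrib,
          mul_add, Finset.mul_sum, mul_assoc]
        ring
    _ = φ x + ∑ i, (a • η + b • ξ) i * ψ i x := by rw [hab, one_mul]

/-- A concave function has decreasing increments along a direction. -/
theorem ConcaveOn.sub_le_sub_of_le {E : Type*} [AddCommGroup E] [Module ℝ E] {s : Set E}
    {F : E → ℝ} (hF : ConcaveOn ℝ s F) {u e : E} {d k : ℝ} (hk : 0 ≤ k) (hkd : k ≤ d)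
    (hd : 0 < d) (hu : u ∈ s) (hv : u + d • e ∈ s) :
    F (u + d • e) - F (u + (d - k) • e) ≤ F (u + k • e) - F u := by
  have h₀ : 0 ≤ k / d := by positivity
  have h₁ : 0 ≤ 1 - k / d := sub_nonneg.2 ((div_le_one hd).2 hkd)
  have hl := hF.2 hu hv h₁ h₀ (by ring)
  have hr := hF.2 hu hv h₀ h₁ (by ring)
  have el : (1 - k / d) • u + (k / d) • (u + d • e) = u + k • e := by
    match_scalars <;> field_simp; ring
  have er : (k / d) • u + (1 - k / d) • (u + d • e) = u + (d - k) • e := by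
    match_scalars <;> field_simp; ring
  rw [el] at hl
  rw [er] at hr
  simp only [smul_eq_mul] at hl hr
  linarith

theorem eventually_sub_smul_single_nonneg {n : ℕ} {η : Fin n → ℝ} (hη : ∀ i, 0 < η i)
    (i : Fin n) : ∀ᶠ k : ℝ in 𝓝[>] 0, 0 ≤ η - k • (Pi.single i 1 : Fin n → ℝ) := by
  filter_upwards [Ioo_mem_nhdsGT (hη i)] with k hk j
  by_cases hj : j = i
  · subst hj
    simpa using hk.2.le
  · simpa [hj] using (hη j).le

theorem HasDPlus.nonneg {n : ℕ} {F : (Fin n → ℝ) → ℝ} (hF : MonotoneOn F (Ici 0))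
    {η : Fin n → ℝ} (hη : 0 ≤ η) {i : Fin n} {D : ℝ} (hD : HasDPlus F η i D) : 0 ≤ D := by
  refine ge_of_tendsto hD ?_
  filter_upwards [self_mem_nhdsWithin] with k (hk : 0 < k)
  have hle : η ≤ η + k • (Pi.single i 1 : Fin n → ℝ) :=
    le_add_of_nonneg_right (smul_nonneg hk.le (Pi.single_nonneg.2 zero_le_one))
  exact div_nonneg (sub_nonneg.2 (hF hη (hη.trans hle) hle)) hk.le

theorem HasDPlus.le_of_hasDMinus {n : ℕ} {F : (Fin n → ℝ) → ℝ} (hF : ConcaveOn ℝ (Ici 0) F)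
    {η : Fin n → ℝ} (hη : ∀ i, 0 < η i) {i : Fin n} {Dp Dm : ℝ}
    (hp : HasDPlus F η i Dp) (hm : HasDMinus F η i Dm) : Dp ≤ Dm := by
  refine le_of_tendsto_of_tendsto hp hm ?_
  filter_upwards [self_mem_nhdsWithin, eventually_sub_smul_single_nonneg hη i]
    with k (hk : 0 < k) hu
  set e : Fin n → ℝ := Pi.single i 1
  have ev : η - k • e + (2 * k) • e = η + k • e := by module
  have em : η - k • e + (2 * k - k) • e = η := by module
  have hv : η - k • e + (2 * k) • e ∈ Ici (0 : Fin n → ℝ) := by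
    have he0 : 0 ≤ e := Pi.single_nonneg.2 zero_le_one
    exact add_nonneg hu (smul_nonneg (by positivity) he0)
  have key := hF.sub_le_sub_of_le hk.le (by linarith) (by linarith) hu hv
  rw [ev, em, sub_add_cancel] at key
  exact div_le_div_of_nonneg_right key hk.le

theorem HasDMinus.le_of_hasDPlus {n : ℕ} {F : (Fin n → ℝ) → ℝ} (hF : ConcaveOn ℝ (Ici 0) F)
    {η : Fin n → ℝ} (hη : 0 ≤ η) {i : Fin n} {h : ℝ} (hh : 0 < h) {Dp Dm : ℝ}
    (hm : HasDMinus F (η + h • (Pi.single i 1 : Fin n → ℝ)) i Dm)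
    (hp : HasDPlus F η i Dp) : Dm ≤ Dp := by
  refine le_of_tendsto_of_tendsto hm hp ?_
  filter_upwards [Ioo_mem_nhdsGT hh] with k hk
  have hv : η + h • (Pi.single i 1 : Fin n → ℝ) ∈ Ici (0 : Fin n → ℝ) :=
    add_nonneg hη (smul_nonneg hh.le (Pi.single_nonneg.2 zero_le_one))
  have key := hF.sub_le_sub_of_le hk.1.le hk.2.le hh hη hv
  rw [sub_smul, ← add_sub_assoc] at key
  exact div_le_div_of_nonneg_right key hk.1.le

/-- monotonicity chain of the one-sided partial derivatives of the
value function: `0 ≤ ∂_i⁺F(η + h eᵢ) ≤ ∂_i⁻F(η + h eᵢ) ≤ ∂_i⁺F(η) ≤ ∂_i⁻F(η)`. -/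
theorem one_sided_derivatives_chain {X : Type*} {n : ℕ} (Q : Set X) (hQ : Q.Nonempty)
    (φ : X → ℝ) (hφ : ∀ x, 0 ≤ φ x)
    (ψ : Fin n → X → ℝ) (hψ : ∀ i x, 0 ≤ ψ i x)
    (η : Fin n → ℝ) (hη : ∀ i, 0 < η i) (i : Fin n) (h : ℝ) (hh : 0 < h)
    (Dp Dm Dph Dmh : ℝ)
    (hDp : HasDPlus (valueFun Q φ ψ) η i Dp)
    (hDm : HasDMinus (valueFun Q φ ψ) η i Dm)
    (hDph : HasDPlus (valueFun Q φ ψ) (η + h • (Pi.single i 1 : Fin n → ℝ)) i Dph)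
    (hDmh : HasDMinus (valueFun Q φ ψ) (η + h • (Pi.single i 1 : Fin n → ℝ)) i Dmh) :
    0 ≤ Dph ∧ Dph ≤ Dmh ∧ Dmh ≤ Dp ∧ Dp ≤ Dm := by
  have hconc := concaveOn_valueFun hQ hφ hψ
  have hη₀ : 0 ≤ η := fun j => (hη j).le
  have hshift : 0 ≤ h • (Pi.single i 1 : Fin n → ℝ) :=
    smul_nonneg hh.le (Pi.single_nonneg.2 zero_le_one)
  exact ⟨hDph.nonneg (monotoneOn_valueFun hQ hφ hψ) (add_nonneg hη₀ hshift),
    hDph.le_of_hasDMinus hconc (fun j => add_pos_of_pos_of_nonneg (hη j) (hshift j)) hDmh,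
    hDmh.le_of_hasDPlus hconc hη₀ hh hDp, hDp.le_of_hasDMinus hconc hη hDm⟩
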